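/- Let 0 < a < b, α ∈ (0,1), and let x : [a,b] → ℝ be continuously differentiable. Then for every t ∈ (a,b], the function F(t) = (1/Γ(1−α))·∫_a^t (ln(t/τ))^{−α}·x(τ)/τ dτ is differentiable at t and t·F'(t) = (x(a)/Γ(1−α))·(ln(t/a))^{−α} + (1/Γ(1−α))·∫_a^t (ln(t/τ))^{−α}·x'(τ) dτ; that is, the two forms of the left Hadamard fractional derivative of order α coincide for C¹ functions. -/

import Mathlib

open Real Set intervalIntegral

/-- Change of variables `τ = s e^{-u}`. -/
theorem hadamard_subst (a s α : ℝ) (ha : 0 < a) (has : a ≤ s) (h : ℝ → ℝ) :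
    ∫ τ in a..s, Real.log (s / τ) ^ (-α) * h τ / τ
      = ∫ u in (0 : ℝ)..Real.log (s / a), u ^ (-α) * h (s * Real.exp (-u)) := by
  have hs : 0 < s := ha.trans_le has
  have hL : 0 ≤ Real.log (s / a) := Real.log_nonneg (by rwa [le_div_iff₀ ha, one_mul])
  rw [intervalIntegral.integral_of_le has, intervalIntegral.integral_of_le hL,
    MeasureTheory.integral_Ioc_eq_integral_Ioo, MeasureTheory.integral_Ioc_eq_integral_Ioo]
  have himg : (fun u => s * Real.exp (-u)) '' Ioo 0 (Real.log (s / a)) = Ioo a s := by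
    ext τ
    constructor
    · rintro ⟨u, ⟨hu0, hu1⟩, rfl⟩
      constructor
      · have h1 : Real.exp u < s / a := (Real.lt_log_iff_exp_lt (by positivity)).1 hu1
        rw [lt_div_iff₀ ha] at h1
        show a < s * Real.exp (-u)
        rw [Real.exp_neg, ← div_eq_mul_inv, lt_div_iff₀ (Real.exp_pos u)]
        linarith
      · have : Real.exp (-u) < 1 := by rw [Real.exp_lt_one_iff]; linarith
        show s * Real.exp (-u) < s
        nlinarith
    · rintro ⟨h1, h2⟩
      have hτ : 0 < τ := ha.trans h1
      refine ⟨Real.log (s / τ), ⟨Real.log_pos (by rwa [lt_div_iff₀ hτ, one_mul]), ?_⟩, ?_⟩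
      · exact Real.log_lt_log (by positivity) (by gcongr)
      · show s * Real.exp (-Real.log (s / τ)) = τ
        rw [Real.exp_neg, Real.exp_log (by positivity)]
        field_simp
  rw [← himg, MeasureTheory.integral_image_eq_integral_abs_deriv_smul (f' := fun u => -(s * Real.exp (-u)))
    measurableSet_Ioo]
  · apply MeasureTheory.setIntegral_congr_fun measurableSet_Ioo
    intro u hu
    have he := Real.exp_pos (-u)
    have h1 : s / (s * Real.exp (-u)) = Real.exp u := by
      rw [Real.exp_neg]; field_simp
    simp only [smul_eq_mul, abs_neg]
    rw [h1, Real.log_exp, abs_of_pos (by positivity)]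
    field_simp
  · intro u _
    have := ((hasDerivAt_neg u).exp.const_mul s).hasDerivWithinAt (s := Ioo 0 (Real.log (s / a)))
    exact this.congr_deriv (by ring)
  · intro u _ v _ huv
    have : Real.exp (-u) = Real.exp (-v) := mul_left_cancel₀ hs.ne' huv
    have := Real.exp_injective this
    linarith

theorem hadamard_ext (a b : ℝ) (hab : a < b) (x x' : ℝ → ℝ)
    (hx' : ∀ τ ∈ Set.Icc a b, HasDerivWithinAt x (x' τ) (Set.Icc a b) τ)
    (hx'cont : ContinuousOn x' (Set.Icc a b)) :
    ∃ (z p : ℝ → ℝ) (C : ℝ), 0 ≤ C ∧ Measurable p ∧ (∀ u v, |z u - z v| ≤ C * |u - v|) ∧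
      (∀ τ, τ ≠ a → HasDerivAt z (p τ) τ) ∧ (∀ τ, τ ≤ a → z τ = 0) ∧ (∀ τ, τ < a → p τ = 0) ∧
      (∀ τ ∈ Icc a b, z τ = x τ - x a ∧ p τ = x' τ) := by
  classical
  obtain ⟨C0, hC0⟩ := isCompact_Icc.exists_bound_of_continuousOn hx'cont
  have hC0' : 0 ≤ C0 := (norm_nonneg _).trans (hC0 a (left_mem_Icc.2 hab.le))
  -- use clamped extension for boundedness
  set r : ℝ → ℝ := IccExtend hab.le (domRestrict (Icc a b) x') with hr
  have hrc : Continuous r := hx'cont.domRestrict.Icc_extend'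
  have hrx : ∀ τ ∈ Icc a b, r τ = x' τ := fun τ hτ => by
    rw [hr, IccExtend_of_mem _ _ hτ]; rfl
  have hrb : ∀ τ, |r τ| ≤ C0 := fun τ => hC0 _ (projIcc a b hab.le τ).2
  set p : ℝ → ℝ := indicator (Ici a) r with hp
  have hpm : Measurable p := hrc.measurable.indicator measurableSet_Ici
  have hpb : ∀ τ, ‖p τ‖ ≤ C0 := fun τ => (norm_indicator_le_norm_self _ _).trans (hrb τ)
  have hpi : ∀ u v, IntervalIntegrable p MeasureTheory.volume u v := fun u v =>
    (intervalIntegrable_const (c := C0)).mono_fun hpm.aestronglyMeasurable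
      (Filter.Eventually.of_forall fun τ => by
        simpa [abs_of_nonneg hC0'] using hpb τ)
  have hp0 : ∀ τ, τ < a → p τ = 0 := fun τ hτ => indicator_of_notMem (by simpa using hτ) _
  have hp1 : ∀ τ, a ≤ τ → p τ = r τ := fun τ hτ => indicator_of_mem (by simpa using hτ) _
  refine ⟨fun τ => ∫ y in a..τ, p y, p, C0, hC0', hpm, ?_, ?_, ?_, hp0, ?_⟩
  · intro u v
    simp only
    rw [intervalIntegral.integral_interval_sub_left (hpi _ _) (hpi _ _)]
    exact intervalIntegral.norm_integral_le_of_norm_le_const fun τ _ => hpb τ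
  · intro τ hτ
    refine intervalIntegral.integral_hasDerivAt_right (hpi _ _)
      hpm.stronglyMeasurable.stronglyMeasurableAtFilter ?_
    rcases lt_or_gt_of_ne hτ with h | h
    · refine (continuousAt_const (y := (0 : ℝ))).congr ?_
      filter_upwards [Iio_mem_nhds h] with y hy using (hp0 y hy).symm
    · refine hrc.continuousAt.congr ?_
      filter_upwards [Ioi_mem_nhds h] with y hy using (hp1 y (le_of_lt hy)).symm
  · intro τ hτ
    simp only
    rw [intervalIntegral.integral_symm, intervalIntegral.integral_of_le hτ,
      MeasureTheory.integral_Ioc_eq_integral_Ioo,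
      MeasureTheory.setIntegral_eq_zero_of_forall_eq_zero fun y hy => hp0 y hy.2, neg_zero]
  · intro τ hτ
    refine ⟨?_, (hp1 τ hτ.1).trans (hrx τ hτ)⟩
    refine intervalIntegral.integral_eq_sub_of_hasDeriv_right ?_ ?_ (hpi _ _)
    · rw [uIcc_of_le hτ.1]
      exact fun y hy => ((hx' y ⟨hy.1, hy.2.trans hτ.2⟩).continuousWithinAt).mono
        (Icc_subset_Icc le_rfl hτ.2)
    · rw [min_eq_left hτ.1, max_eq_right hτ.1]
      intro y hy
      have hyI : y ∈ Ioo a b := ⟨hy.1, hy.2.trans_le hτ.2⟩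
      rw [hp1 y hy.1.le, hrx y ⟨hyI.1.le, hyI.2.le⟩]
      exact ((hx' y ⟨hyI.1.le, hyI.2.le⟩).hasDerivAt (Icc_mem_nhds hyI.1 hyI.2)).hasDerivWithinAt

/-- For a `C¹` function `x` on `[a,b]` (`0 < a < b`) and `α ∈ (0,1)`,
the function `F(t) = (1/Γ(1−α))·∫_a^t (ln(t/τ))^{−α}·x(τ)/τ dτ` is differentiable at
every `t ∈ (a,b]` (within `[a,b]`) and
`t·F'(t) = (x(a)/Γ(1−α))·(ln(t/a))^{−α} + (1/Γ(1−α))·∫_a^t (ln(t/τ))^{−α}·x'(τ) dτ`;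
i.e. the two forms of the left Hadamard fractional derivative coincide for `C¹`
functions. -/
theorem hadamard_deriv_equivalent_representations
    (a b α : ℝ) (ha : 0 < a) (hab : a < b) (hα : α ∈ Set.Ioo (0 : ℝ) 1)
    (x x' : ℝ → ℝ)
    (hx' : ∀ τ ∈ Set.Icc a b, HasDerivWithinAt x (x' τ) (Set.Icc a b) τ)
    (hx'cont : ContinuousOn x' (Set.Icc a b))
    (t : ℝ) (ht : t ∈ Set.Ioc a b) :
    ∃ d : ℝ,
      HasDerivWithinAt
        (fun s => (1 / Real.Gamma (1 - α))
          * ∫ τ in a..s, Real.log (s / τ) ^ (-α) * x τ / τ)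
        d (Set.Icc a b) t ∧
      t * d = x a / Real.Gamma (1 - α) * Real.log (t / a) ^ (-α)
        + (1 / Real.Gamma (1 - α)) * ∫ τ in a..t, Real.log (t / τ) ^ (-α) * x' τ := by
  obtain ⟨hα0, hα1⟩ := hα
  obtain ⟨z, p, C, hC, hpm, hzL, hzd, hz0, hp0, hzx⟩ := hadamard_ext a b hab x x' hx' hx'cont
  have ht0 : 0 < t := ha.trans ht.1
  have hzc : Continuous z := by
    refine (LipschitzWith.of_dist_le_mul (K := ⟨C, hC⟩) fun u v => ?_).continuous
    exact hzL u v
  set M := Real.log (b / a) with hM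
  have hM0 : 0 ≤ M := Real.log_nonneg (by rw [le_div_iff₀ ha]; linarith)
  have hri : ∀ u v, IntervalIntegrable (fun y : ℝ => y ^ (-α)) MeasureTheory.volume u v :=
    fun u v => intervalIntegral.intervalIntegrable_rpow' (by linarith)
  have hzi : ∀ s u v, IntervalIntegrable (fun y : ℝ => y ^ (-α) * z (s * Real.exp (-y)))
      MeasureTheory.volume u v := fun s u v =>
    (hri u v).mul_continuousOn (by fun_prop)
  have hLge : ∀ s ∈ Icc a b, 0 ≤ Real.log (s / a) ∧ Real.log (s / a) ≤ M := fun s hs =>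
    ⟨Real.log_nonneg (by rw [le_div_iff₀ ha]; linarith [hs.1]),
      Real.log_le_log (div_pos (ha.trans_le hs.1) ha) (by gcongr; exact hs.2)⟩
  have hin : ∀ s ∈ Icc a b, ∀ u ∈ Ioc 0 (Real.log (s / a)), s * Real.exp (-u) ∈ Icc a b := by
    intro s hs u hu
    have hs0 := ha.trans_le hs.1
    constructor
    · have h1 := (Real.le_log_iff_exp_le (div_pos hs0 ha)).1 hu.2
      rw [le_div_iff₀ ha] at h1
      rw [Real.exp_neg, ← div_eq_mul_inv, le_div_iff₀ (Real.exp_pos u)]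
      linarith
    · have : Real.exp (-u) ≤ 1 := by rw [Real.exp_le_one_iff]; linarith [hu.1]
      nlinarith [hs.2]
  have hout : ∀ s ∈ Icc a b, ∀ u, Real.log (s / a) < u → s * Real.exp (-u) < a := by
    intro s hs u hu
    have hs0 := ha.trans_le hs.1
    have h1 := (Real.log_lt_iff_lt_exp (div_pos hs0 ha)).1 hu
    rw [div_lt_iff₀ ha] at h1
    rw [Real.exp_neg, ← div_eq_mul_inv, div_lt_iff₀ (Real.exp_pos u)]
    linarith
  -- rewriting of the integral
  have hF : ∀ s ∈ Icc a b, ∫ τ in a..s, Real.log (s / τ) ^ (-α) * x τ / τ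
      = x a * (Real.log (s / a) ^ (1 - α) / (1 - α))
        + ∫ u in (0 : ℝ)..M, u ^ (-α) * z (s * Real.exp (-u)) := by
    intro s hs
    obtain ⟨hL0, hLM⟩ := hLge s hs
    rw [hadamard_subst a s α ha hs.1 x]
    have e1 : ∫ u in (0 : ℝ)..Real.log (s / a), u ^ (-α) * x (s * Real.exp (-u))
        = ∫ u in (0 : ℝ)..Real.log (s / a),
          (x a * u ^ (-α) + u ^ (-α) * z (s * Real.exp (-u))) := by
      refine intervalIntegral.integral_congr_ae (Filter.Eventually.of_forall fun u hu => ?_)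
      rw [uIoc_of_le hL0] at hu
      rw [(hzx _ (hin s hs u hu)).1]
      ring
    have e2 : ∫ u in (Real.log (s / a))..M, u ^ (-α) * z (s * Real.exp (-u)) = 0 := by
      rw [intervalIntegral.integral_of_le hLM]
      refine MeasureTheory.setIntegral_eq_zero_of_forall_eq_zero fun u hu => ?_
      rw [hz0 _ (hout s hs u hu.1).le, mul_zero]
    rw [e1, intervalIntegral.integral_add ((hri _ _).const_mul _) (hzi _ _ _),
      intervalIntegral.integral_const_mul, integral_rpow (Or.inl (by linarith)),
      ← intervalIntegral.integral_add_adjacent_intervals (hzi s 0 (Real.log (s / a))) (hzi s _ M),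
      e2, add_zero, Real.zero_rpow (by linarith), sub_zero]
    congr 3 <;> ring_nf
  have htI : t ∈ Icc a b := ⟨ht.1.le, ht.2⟩
  obtain ⟨hL0, hLM⟩ := hLge t htI
  have hLpos : 0 < Real.log (t / a) := Real.log_pos (by rw [lt_div_iff₀ ha]; linarith [ht.1])
  -- differentiation under the integral sign
  obtain ⟨hI, hD⟩ := intervalIntegral.hasDerivAt_integral_of_dominated_loc_of_lip
    (𝕜 := ℝ) (μ := MeasureTheory.volume) (a := 0) (b := M) (x₀ := t) (s := univ)
    (F := fun s u => u ^ (-α) * z (s * Real.exp (-u)))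
    (F' := fun u => u ^ (-α) * (p (t * Real.exp (-u)) * Real.exp (-u)))
    (bound := fun u => u ^ (-α) * C)
    Filter.univ_mem
    (Filter.Eventually.of_forall fun s => by
      have := (hzi s 0 M).aestronglyMeasurable
      rwa [uIoc_of_le hM0])
    (hzi t 0 M)
    (by
      refine Measurable.aestronglyMeasurable ?_
      have : Measurable fun u : ℝ => u ^ (-α) := by fun_prop
      fun_prop)
    (Filter.Eventually.of_forall fun u hu => by
      rw [uIoc_of_le hM0] at hu
      refine LipschitzOnWith.of_dist_le_mul fun s _ r _ => ?_
      have hu' : 0 ≤ u ^ (-α) := Real.rpow_nonneg hu.1.le _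
      have he : Real.exp (-u) ≤ 1 := by rw [Real.exp_le_one_iff]; linarith [hu.1]
      rw [Real.coe_nnabs, abs_of_nonneg (mul_nonneg hu' hC), Real.dist_eq, Real.dist_eq, ← mul_sub,
        abs_mul, abs_of_nonneg hu', mul_assoc]
      refine mul_le_mul_of_nonneg_left ((hzL _ _).trans ?_) hu'
      rw [← sub_mul, abs_mul, abs_of_pos (Real.exp_pos _)]
      exact mul_le_mul_of_nonneg_left (mul_le_of_le_one_right (abs_nonneg _) he) hC)
    ((hri 0 M).mul_const C)
    (by
      filter_upwards [MeasureTheory.Measure.ae_ne MeasureTheory.volume (Real.log (t / a))] with u hu _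
      have hne : t * Real.exp (-u) ≠ a := by
        intro h
        apply hu
        rw [← h]
        rw [show t / (t * Real.exp (-u)) = Real.exp u by rw [Real.exp_neg]; field_simp,
          Real.log_exp]
      have h1 : HasDerivAt (fun s : ℝ => s * Real.exp (-u)) (Real.exp (-u)) t := by
        simpa using (hasDerivAt_id t).mul_const (Real.exp (-u))
      exact ((hzd _ hne).comp t h1).const_mul _)
  set d0 := ∫ u in (0 : ℝ)..M, u ^ (-α) * (p (t * Real.exp (-u)) * Real.exp (-u)) with hd0
  have hd0t : t * d0 = ∫ τ in a..t, Real.log (t / τ) ^ (-α) * x' τ := by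
    have e0 : ∫ τ in a..t, Real.log (t / τ) ^ (-α) * x' τ
        = ∫ τ in a..t, Real.log (t / τ) ^ (-α) * (fun y => y * x' y) τ / τ := by
      refine intervalIntegral.integral_congr fun τ hτ => ?_
      rw [uIcc_of_le ht.1.le] at hτ
      have : 0 < τ := ha.trans_le hτ.1
      simp only
      field_simp
    have e2 : ∫ u in (Real.log (t / a))..M,
        u ^ (-α) * (p (t * Real.exp (-u)) * Real.exp (-u)) = 0 := by
      rw [intervalIntegral.integral_of_le hLM]
      refine MeasureTheory.setIntegral_eq_zero_of_forall_eq_zero fun u hu => ?_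
      rw [hp0 _ (hout t htI u hu.1)]
      ring
    have hmem : Real.log (t / a) ∈ uIcc 0 M := by rw [uIcc_of_le hM0]; exact ⟨hL0, hLM⟩
    rw [e0, hadamard_subst a t α ha ht.1.le, hd0,
      ← intervalIntegral.integral_add_adjacent_intervals
        (hI.mono_set (uIcc_subset_uIcc_left hmem)) (hI.mono_set (uIcc_subset_uIcc_right hmem)),
      e2, add_zero, ← intervalIntegral.integral_const_mul]
    refine intervalIntegral.integral_congr_ae (Filter.Eventually.of_forall fun u hu => ?_)
    rw [uIoc_of_le hL0] at hu
    rw [(hzx _ (hin t htI u hu)).2]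
    ring
  have hlog : HasDerivAt (fun s : ℝ => Real.log (s / a) ^ (1 - α) / (1 - α))
      (Real.log (t / a) ^ (-α) / t) t := by
    have h1 : HasDerivAt (fun s : ℝ => Real.log (s / a)) (1 / t) t := by
      have := ((hasDerivAt_id t).div_const a).log (by simp; exact ⟨ht0.ne', ha.ne'⟩)
      refine this.congr_deriv ?_
      show 1 / a / (t / a) = 1 / t
      field_simp
    have h2 := (h1.rpow_const (p := 1 - α) (Or.inl hLpos.ne')).div_const (1 - α)
    have : 1 - α ≠ 0 := by linarith
    refine h2.congr_deriv ?_
    rw [show 1 - α - 1 = -α by ring]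
    field_simp
  refine ⟨1 / Real.Gamma (1 - α) * (x a * (Real.log (t / a) ^ (-α) / t) + d0), ?_, ?_⟩
  · refine HasDerivWithinAt.congr
      (((hlog.const_mul (x a)).add hD).const_mul (1 / Real.Gamma (1 - α))).hasDerivWithinAt
      (fun s hs => ?_) ?_
    · simp only [Pi.add_apply, hF s hs]
    · simp only [Pi.add_apply, hF t htI]
  · rw [← hd0t]
    field_simp
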